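/- Let μ be a Radon measure on ℝ^d and let w_I ≥ 0, I ∈ 𝒟, satisfy the Carleson measure condition: for every J ∈ 𝒟, Σ_{I∈𝒟, I⊆J} w_I ≤ C μ(J). Then for every measurable f ≥ 0 and every p ∈ (1,∞), with 1/p + 1/p' = 1, one has Σ_{I∈𝒟, μ(I)>0} (μ(I)^{-1} ∫_I f dμ)^p w_I ≤ (p')^p C ‖f‖_{L^p(μ)}^p. -/

import Mathlib

open MeasureTheory ENNReal Set

noncomputable section

/-- Index of a dyadic cube in `ℝ^d`: a pair `(k, m)` with `k : ℤ` the scale and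
`m : Fin d → ℤ` the position; the cube is `2^{-k}(m + [0,1)^d)`. -/
abbrev DIdx (d : ℕ) := ℤ × (Fin d → ℤ)

/-- The dyadic cube `2^{-k}(m + [0,1)^d)` associated to an index. -/
def dyCube {d : ℕ} (I : DIdx d) : Set (Fin d → ℝ) :=
  {x | ∀ i, (I.2 i : ℝ) * (2 : ℝ) ^ (-I.1) ≤ x i ∧ x i < ((I.2 i : ℝ) + 1) * (2 : ℝ) ^ (-I.1)}

/-- The average `μ(I)^{-1} ∫_I f dμ` of a nonnegative function over a dyadic cube. -/
def dyAvg {d : ℕ} (μ : Measure (Fin d → ℝ)) (f : (Fin d → ℝ) → ℝ) (I : DIdx d) : ℝ≥0∞ :=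
  (μ (dyCube I))⁻¹ * ∫⁻ x in dyCube I, ENNReal.ofReal (f x) ∂μ

/-- In a nested family of sets, the union of a finite subfamily is the disjoint union of some of
its members, and every member lies in one of those. -/
lemma exists_pairwiseDisjoint_cover_of_nested {α ι : Type*} (S : ι → Set α)
    (hS : ∀ i j, S i ⊆ S j ∨ S j ⊆ S i ∨ Disjoint (S i) (S j)) (F : Finset ι) :
    ∃ G ⊆ F, (G : Set ι).PairwiseDisjoint S ∧ ∀ i ∈ F, ∃ j ∈ G, S i ⊆ S j := by
  classical
  induction F using Finset.induction_on with
  | empty => exact ⟨∅, by simp⟩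
  | insert a F _ ih =>
    obtain ⟨G, hGF, hG, hcov⟩ := ih
    by_cases ha : ∃ j ∈ G, S a ⊆ S j
    · refine ⟨G, hGF.trans (Finset.subset_insert _ _), hG, fun i hi => ?_⟩
      rcases Finset.mem_insert.1 hi with rfl | hi
      exacts [ha, hcov i hi]
    · push Not at ha
      refine ⟨insert a (G.filter fun j => ¬ S j ⊆ S a),
        Finset.insert_subset_insert _ ((Finset.filter_subset _ _).trans hGF), ?_, ?_⟩
      · rw [Finset.coe_insert]
        refine (hG.subset (Finset.coe_subset.2 (Finset.filter_subset _ _))).insert ?_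
        intro j hj _
        obtain ⟨hj, hja⟩ := Finset.mem_filter.1 hj
        rcases hS a j with h | h | h
        exacts [absurd h (ha j hj), absurd h hja, h]
      · intro i hi
        rcases Finset.mem_insert.1 hi with rfl | hi
        · exact ⟨i, Finset.mem_insert_self _ _, subset_rfl⟩
        · obtain ⟨j, hj, hij⟩ := hcov i hi
          by_cases hja : S j ⊆ S a
          · exact ⟨a, Finset.mem_insert_self _ _, hij.trans hja⟩
          · exact ⟨j, Finset.mem_insert_of_mem (Finset.mem_filter.2 ⟨hj, hja⟩), hij⟩

/-- **Doob's `L^p` inequality** deduced from a weak type bound on superlevel sets. -/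
lemma lintegral_rpow_le_of_weak_type {α : Type*} [MeasurableSpace α] {μ : Measure α}
    {f : α → ℝ≥0∞} (hf : Measurable f) {g : α → ℝ} (hg : Measurable g) (hg0 : 0 ≤ g)
    {p q : ℝ} (hpq : p.HolderConjugate q)
    (hweak : ∀ t > 0, ENNReal.ofReal t * μ {x | t < g x} ≤ ∫⁻ x in {x | t < g x}, f x ∂μ)
    (hfin : ∫⁻ x, ENNReal.ofReal (g x ^ p) ∂μ ≠ ∞) :
    ∫⁻ x, ENNReal.ofReal (g x ^ p) ∂μ ≤ ENNReal.ofReal (q ^ p) * ∫⁻ x, f x ^ p ∂μ := by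
  have hp := hpq.lt
  have hp1 := hpq.sub_one_pos
  set A := ∫⁻ x, ENNReal.ofReal (g x ^ p) ∂μ with hA
  set B := ∫⁻ x, f x ^ p ∂μ
  have hAq : ∫⁻ x, ENNReal.ofReal (g x ^ (p - 1)) ^ q ∂μ = A := by
    refine lintegral_congr fun x => ?_
    rw [ENNReal.ofReal_rpow_of_nonneg (Real.rpow_nonneg (hg0 x) _) hpq.symm.nonneg,
      ← Real.rpow_mul (hg0 x), hpq.sub_one_mul_conj]
  have hmeas : Measurable fun x => ENNReal.ofReal (g x ^ (p - 1)) := by fun_prop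
  have key : A ≤ ENNReal.ofReal q * ∫⁻ x, (f * fun x => ENNReal.ofReal (g x ^ (p - 1))) x ∂μ := by
    rw [← lintegral_withDensity_eq_lintegral_mul μ hf hmeas,
      lintegral_rpow_eq_lintegral_meas_lt_mul _ (.of_forall hg0) hg.aemeasurable hp1,
      ← mul_assoc, ← ENNReal.ofReal_mul hpq.symm.nonneg, mul_comm q, hpq.sub_one_mul_conj, hA,
      lintegral_rpow_eq_lintegral_meas_lt_mul _ (.of_forall hg0) hg.aemeasurable hpq.pos]
    gcongr ENNReal.ofReal p * ?_
    refine setLIntegral_mono' measurableSet_Ioi fun t (ht : 0 < t) => ?_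
    rw [withDensity_apply _ (measurableSet_lt measurable_const hg)]
    calc μ {x | t < g x} * ENNReal.ofReal (t ^ (p - 1))
        = ENNReal.ofReal t * μ {x | t < g x} * ENNReal.ofReal (t ^ (p - 1 - 1)) := by
          rw [mul_comm (ENNReal.ofReal t), mul_assoc, ← ENNReal.ofReal_mul ht.le,
            Real.rpow_sub_one ht.ne' (p - 1), mul_div_cancel₀ _ ht.ne']
      _ ≤ _ := by gcongr; exact hweak t ht
  have hoelder : A ≤ ENNReal.ofReal q * (B ^ (1 / p) * A ^ (1 / q)) := by
    refine key.trans ?_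
    gcongr
    exact (ENNReal.lintegral_mul_le_Lp_mul_Lq μ hpq hf.aemeasurable hmeas.aemeasurable).trans_eq
      (by rw [hAq])
  rcases eq_or_ne A 0 with h0 | h0
  · simp [h0]
  have hsplit : A = A ^ (1 / p) * A ^ (1 / q) := by
    rw [← ENNReal.rpow_add _ _ h0 hfin, one_div, one_div, hpq.inv_add_inv_eq_one, ENNReal.rpow_one]
  have hroot : A ^ (1 / p) ≤ ENNReal.ofReal q * B ^ (1 / p) := by
    rw [← mul_assoc] at hoelder
    nth_rewrite 1 [hsplit] at hoelder
    refine (ENNReal.mul_le_mul_iff_left ?_ ?_).1 hoelder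
    · exact (ENNReal.rpow_pos (pos_iff_ne_zero.2 h0) hfin).ne'
    · exact ENNReal.rpow_ne_top_of_nonneg (one_div_nonneg.2 hpq.symm.nonneg) hfin
  have := ENNReal.rpow_le_rpow hroot hpq.nonneg
  rwa [ENNReal.mul_rpow_of_nonneg _ _ hpq.nonneg, ← ENNReal.rpow_mul, ← ENNReal.rpow_mul,
    one_div_mul_cancel hpq.ne_zero, ENNReal.rpow_one, ENNReal.rpow_one,
    ENNReal.ofReal_rpow_of_nonneg hpq.symm.nonneg hpq.nonneg] at this

/-- The Carleson embedding for a finite nested family of sets. -/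
lemma carleson_embedding_finset {α ι : Type*} [MeasurableSpace α] {μ : Measure α}
    {S : ι → Set α} (hSm : ∀ i, MeasurableSet (S i))
    (hS : ∀ i j, S i ⊆ S j ∨ S j ⊆ S i ∨ Disjoint (S i) (S j)) (hSμ : ∀ i, μ (S i) ≠ ∞)
    (F : Finset ι) (w : ι → ℝ≥0∞) {C : ℝ≥0∞} (hC : C ≠ ∞)
    (hw : ∀ j, ∀ F' : Finset ι, (∀ i ∈ F', S i ⊆ S j) → ∑ i ∈ F', w i ≤ C * μ (S j))
    {f : α → ℝ≥0∞} (hf : Measurable f) (a : ι → NNReal)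
    (ha : ∀ i, a i * μ (S i) ≤ ∫⁻ x in S i, f x ∂μ)
    {p q : ℝ} (hpq : p.HolderConjugate q) :
    ∑ i ∈ F, (a i : ℝ≥0∞) ^ p * w i ≤ ENNReal.ofReal (q ^ p) * C * ∫⁻ x, f x ^ p ∂μ := by
  classical
  let g : α → ℝ := fun x => ((F.sup fun i => (S i).indicator (fun _ => a i) x : NNReal) : ℝ)
  have hlevel : ∀ t : ℝ, 0 < t → {x | t < g x} = ⋃ i ∈ F.filter (fun i => t < a i), S i := by
    intro t ht
    lift t to NNReal using ht.le
    have ht' : 0 < t := by exact_mod_cast ht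
    ext x
    simp only [g, mem_ofPred_eq, NNReal.coe_lt_coe, Finset.lt_sup_iff, Finset.mem_filter,
      mem_iUnion, exists_prop, and_assoc]
    refine exists_congr fun i => and_congr_right fun _ => ?_
    by_cases hx : x ∈ S i <;> simp [hx]
  have hgm : Measurable g := by
    refine measurable_coe_nnreal_real.comp ?_
    have : (fun x => F.sup fun i => (S i).indicator (fun _ => a i) x) =
        F.sup fun i => (S i).indicator (fun _ => a i) := by
      ext x; simp [Finset.sup_apply]
    rw [this]
    exact Finset.sup_induction measurable_const (fun _ h _ h' => h.sup h')
      fun i _ => measurable_const.indicator (hSm i)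
  have hg0 : 0 ≤ g := fun x => NNReal.coe_nonneg _
  have hcover : ∀ t : ℝ, 0 < t → ∃ G : Finset ι, (G : Set ι).PairwiseDisjoint S ∧
      (∀ i ∈ G, t < a i) ∧ (∀ i ∈ F, t < a i → ∃ j ∈ G, S i ⊆ S j) ∧
      {x | t < g x} = ⋃ i ∈ G, S i := by
    intro t ht
    obtain ⟨G, hGF, hG, hcov⟩ :=
      exists_pairwiseDisjoint_cover_of_nested S hS (F.filter fun i => t < a i)
    refine ⟨G, hG, fun i hi => (Finset.mem_filter.1 (hGF hi)).2,
      fun i hi hti => hcov i (Finset.mem_filter.2 ⟨hi, hti⟩), ?_⟩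
    rw [hlevel t ht]
    refine subset_antisymm (iUnion₂_subset fun i hi => ?_) (biUnion_subset_biUnion_left hGF)
    obtain ⟨j, hj, hij⟩ := hcov i hi
    exact hij.trans (subset_biUnion_of_mem (u := S) (Finset.mem_coe.2 hj))
  have hweak : ∀ t > 0, ENNReal.ofReal t * μ {x | t < g x} ≤ ∫⁻ x in {x | t < g x}, f x ∂μ := by
    intro t ht
    obtain ⟨G, hG, hGt, -, hset⟩ := hcover t ht
    rw [hset, measure_biUnion_finset hG fun i _ => hSm i,
      lintegral_biUnion_finset hG fun i _ => hSm i, Finset.mul_sum]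
    refine Finset.sum_le_sum fun i hi => le_trans ?_ (ha i)
    gcongr
    exact ENNReal.ofReal_le_of_le_toReal (by simpa using (hGt i hi).le)
  have hfin : ∫⁻ x, ENNReal.ofReal (g x ^ p) ∂μ ≠ ∞ := by
    have hle : ∀ x, ENNReal.ofReal (g x ^ p) ≤
        ∑ i ∈ F, (S i).indicator (fun _ => ENNReal.ofReal ((a i : ℝ) ^ p)) x := by
      intro x
      rcases F.eq_empty_or_nonempty with rfl | hF
      · simp [g, hpq.ne_zero]
      obtain ⟨i, hi, hix⟩ := Finset.exists_mem_eq_sup F hF fun i => (S i).indicator (fun _ => a i) x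
      refine le_trans ?_ (Finset.single_le_sum (fun _ _ => zero_le) hi)
      simp only [g, hix]
      by_cases hx : x ∈ S i <;> simp [hx, hpq.ne_zero]
    refine ((lintegral_mono hle).trans_lt ?_).ne
    rw [lintegral_finsetSum _ fun i _ => measurable_const.indicator (hSm i)]
    refine ENNReal.sum_lt_top.2 fun i _ => ?_
    rw [lintegral_indicator_const (hSm i)]
    exact ENNReal.mul_lt_top ENNReal.ofReal_lt_top (hSμ i).lt_top
  let _ : MeasurableSpace ι := ⊤
  let ν : Measure ι := ∑ i ∈ F, w i • Measure.dirac i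
  have hν : ∀ T : Set ι, ν T = ∑ i ∈ F.filter (· ∈ T), w i := by
    intro T
    simp only [ν, Measure.coe_finsetSum, Finset.sum_apply, Measure.smul_apply, smul_eq_mul,
      Measure.dirac_apply, Finset.sum_filter]
    refine Finset.sum_congr rfl fun i _ => ?_
    by_cases hi : i ∈ T <;> simp [hi]
  have hsum : ∑ i ∈ F, (a i : ℝ≥0∞) ^ p * w i = ∫⁻ i, ENNReal.ofReal ((a i : ℝ) ^ p) ∂ν := by
    simp only [ν, lintegral_finsetSum_measure, lintegral_smul_measure, lintegral_dirac]
    refine Finset.sum_congr rfl fun i _ => ?_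
    rw [← ENNReal.ofReal_rpow_of_nonneg (a i).coe_nonneg hpq.nonneg, ENNReal.ofReal_coe_nnreal, smul_eq_mul,
      mul_comm]
  have hνμ : ∀ t : ℝ, 0 < t → ν {i | t < a i} ≤ C * μ {x | t < g x} := by
    intro t ht
    obtain ⟨G, hG, -, hcov, hset⟩ := hcover t ht
    rw [hset, measure_biUnion_finset hG fun i _ => hSm i, Finset.mul_sum, hν]
    choose! φ hφG hφ using hcov
    simp only [mem_ofPred_eq]
    rw [← Finset.sum_fiberwise_of_maps_to (g := φ) (t := G) fun i hi =>
      hφG i (Finset.mem_filter.1 hi).1 (Finset.mem_filter.1 hi).2]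
    refine Finset.sum_le_sum fun j _ => hw j _ fun i hi => ?_
    obtain ⟨hiF, rfl⟩ := Finset.mem_filter.1 hi
    exact hφ i (Finset.mem_filter.1 hiF).1 (Finset.mem_filter.1 hiF).2
  calc ∑ i ∈ F, (a i : ℝ≥0∞) ^ p * w i
      ≤ C * ∫⁻ x, ENNReal.ofReal (g x ^ p) ∂μ := by
        rw [hsum, lintegral_rpow_eq_lintegral_meas_lt_mul ν (.of_forall fun i => (a i).coe_nonneg)
          measurable_from_top.aemeasurable hpq.pos,
          lintegral_rpow_eq_lintegral_meas_lt_mul μ (.of_forall hg0) hgm.aemeasurable hpq.pos,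
          mul_left_comm, ← lintegral_const_mul' _ _ hC]
        gcongr ENNReal.ofReal p * ?_
        refine setLIntegral_mono' measurableSet_Ioi fun t (ht : 0 < t) => ?_
        rw [← mul_assoc]
        gcongr
        exact hνμ t ht
    _ ≤ C * (ENNReal.ofReal (q ^ p) * ∫⁻ x, f x ^ p ∂μ) := by
        gcongr
        exact lintegral_rpow_le_of_weak_type hf hgm hg0 hpq hweak hfin
    _ = _ := by ring

lemma mem_dyCube_iff_floor {d : ℕ} {I : DIdx d} {x : Fin d → ℝ} :
    x ∈ dyCube I ↔ ∀ i, ⌊x i * (2 : ℝ) ^ I.1⌋ = I.2 i := by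
  refine forall_congr' fun i => ?_
  have h2 : (0 : ℝ) < 2 ^ I.1 := by positivity
  rw [Int.floor_eq_iff, zpow_neg, ← div_eq_mul_inv, ← div_eq_mul_inv, div_le_iff₀ h2,
    lt_div_iff₀ h2]

lemma measurableSet_dyCube {d : ℕ} (I : DIdx d) : MeasurableSet (dyCube I) := by
  simp only [dyCube, ← mem_Ico, ofPred_forall]
  exact .iInter fun i => measurable_pi_apply i measurableSet_Ico

lemma measure_dyCube_ne_top {d : ℕ} (μ : Measure (Fin d → ℝ)) [IsFiniteMeasureOnCompacts μ]
    (I : DIdx d) : μ (dyCube I) ≠ ∞ := by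
  refine ((measure_mono ?_).trans_lt (isCompact_Icc (a := fun i => (I.2 i : ℝ) * (2 : ℝ) ^ (-I.1))
    (b := fun i => ((I.2 i : ℝ) + 1) * (2 : ℝ) ^ (-I.1))).measure_lt_top).ne
  exact fun x hx => ⟨fun i => (hx i).1, fun i => (hx i).2.le⟩

lemma dyCube_subset_of_mem {d : ℕ} {I J : DIdx d} (hIJ : J.1 ≤ I.1) {y : Fin d → ℝ}
    (hyI : y ∈ dyCube I) (hyJ : y ∈ dyCube J) : dyCube I ⊆ dyCube J := by
  obtain ⟨n, hn⟩ := Int.le.dest hIJ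
  have hfloor (z : ℝ) : ⌊z * (2 : ℝ) ^ J.1⌋ = ⌊z * (2 : ℝ) ^ I.1⌋ / ((2 ^ n : ℕ) : ℤ) := by
    rw [← Int.floor_div_natCast, ← hn, zpow_add₀ two_ne_zero]
    congr 1
    push_cast
    rw [zpow_natCast, ← mul_assoc, mul_div_cancel_right₀ _ (by positivity)]
  rw [mem_dyCube_iff_floor] at hyI hyJ
  intro x hx
  rw [mem_dyCube_iff_floor] at hx ⊢
  intro i
  rw [hfloor, hx i, ← hyI i, ← hfloor, hyJ i]

lemma dyCube_nested {d : ℕ} (I J : DIdx d) :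
    dyCube I ⊆ dyCube J ∨ dyCube J ⊆ dyCube I ∨ Disjoint (dyCube I) (dyCube J) := by
  by_cases h : Disjoint (dyCube I) (dyCube J)
  · exact .inr (.inr h)
  obtain ⟨y, hyI, hyJ⟩ := not_disjoint_iff.1 h
  rcases le_total J.1 I.1 with hIJ | hIJ
  · exact .inl (dyCube_subset_of_mem hIJ hyI hyJ)
  · exact .inr (.inl (dyCube_subset_of_mem hIJ hyJ hyI))

/-- **Martingale (dyadic) Carleson Embedding Theorem**, with constant `(p')^p C`. -/
theorem carleson_embedding (d : ℕ) (μ : Measure (Fin d → ℝ)) [IsFiniteMeasureOnCompacts μ]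
    (w : DIdx d → ℝ≥0∞) (C : ℝ)
    (hCarl : ∀ J : DIdx d,
      ∑' I : {I : DIdx d // dyCube I ⊆ dyCube J}, w I.1 ≤ ENNReal.ofReal C * μ (dyCube J))
    (f : (Fin d → ℝ) → ℝ) (hf : Measurable f) (hf0 : 0 ≤ f)
    (p p' : ℝ) (hp : 1 < p) (hpp' : 1 / p + 1 / p' = 1) :
    ∑' I : {I : DIdx d // 0 < μ (dyCube I)}, (dyAvg μ f I.1) ^ p * w I.1
      ≤ ENNReal.ofReal (p' ^ p * C) * eLpNorm f (ENNReal.ofReal p) μ ^ p := by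
  have hpq : p.HolderConjugate p' := Real.holderConjugate_iff.2 ⟨hp, by simpa using hpp'⟩
  have hnorm : eLpNorm f (ENNReal.ofReal p) μ ^ p = ∫⁻ x, ENNReal.ofReal (f x) ^ p ∂μ := by
    rw [eLpNorm_eq_lintegral_rpow_enorm_toReal (by simpa using hpq.pos) ENNReal.ofReal_ne_top,
      ENNReal.toReal_ofReal hpq.nonneg, ← ENNReal.rpow_mul, one_div_mul_cancel hpq.ne_zero,
      ENNReal.rpow_one]
    exact lintegral_congr fun x => by rw [Real.enorm_of_nonneg (hf0 x)]
  have hqp : 0 < p' ^ p := Real.rpow_pos_of_pos hpq.symm.pos p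
  rcases le_or_gt C 0 with hC | hC
  · have hw0 : ∀ I, w I = 0 := fun I => by
      have h := (ENNReal.le_tsum (f := fun K : {K : DIdx d // dyCube K ⊆ dyCube I} => w K.1)
        ⟨I, subset_rfl⟩).trans (hCarl I)
      simpa [ENNReal.ofReal_of_nonpos hC] using h
    simp [hw0]
  rcases eq_or_ne (eLpNorm f (ENNReal.ofReal p) μ) ∞ with htop | htop
  · rw [htop, ENNReal.top_rpow_of_pos hpq.pos,
      ENNReal.mul_top (ENNReal.ofReal_pos.2 (mul_pos hqp hC)).ne']
    exact le_top
  have hint : ∀ I : DIdx d, ∫⁻ x in dyCube I, ENNReal.ofReal (f x) ∂μ ≠ ∞ := fun I => by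
    have : IsFiniteMeasure (μ.restrict (dyCube I)) :=
      isFiniteMeasure_restrict.2 (measure_dyCube_ne_top μ I)
    have hLp : MemLp f (ENNReal.ofReal p) μ := ⟨hf.aestronglyMeasurable, htop.lt_top⟩
    have hi := (hLp.restrict (dyCube I)).integrable (by simpa using hp.le)
    exact hi.lintegral_lt_top.ne
  have havg : ∀ I : {I : DIdx d // 0 < μ (dyCube I)}, dyAvg μ f I.1 ≠ ∞ := fun I =>
    ENNReal.mul_ne_top (ENNReal.inv_ne_top.2 I.2.ne') (hint I.1)
  rw [ENNReal.tsum_eq_iSup_sum]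
  refine iSup_le fun F => ?_
  rw [hnorm, ENNReal.ofReal_mul hqp.le]
  have := carleson_embedding_finset (μ := μ)
    (S := fun I : {I : DIdx d // 0 < μ (dyCube I)} => dyCube I.1)
    (fun I => measurableSet_dyCube I.1) (fun I J => dyCube_nested I.1 J.1)
    (fun I => measure_dyCube_ne_top μ I.1) F (fun I => w I.1) (C := ENNReal.ofReal C)
    ENNReal.ofReal_ne_top ?_ hf.ennreal_ofReal (fun I => (dyAvg μ f I.1).toNNReal) ?_ hpq
  · simpa only [ENNReal.coe_toNNReal (havg _)] using this
  · intro J F' hF'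
    refine le_trans ?_ (hCarl J.1)
    refine le_of_le_of_eq ?_ (tsum_subtype {I : DIdx d | dyCube I ⊆ dyCube J.1} w).symm
    refine le_trans (le_of_eq ?_) (ENNReal.sum_le_tsum (F'.map (Function.Embedding.subtype _)))
    rw [Finset.sum_map]
    refine Finset.sum_congr rfl fun I hI => (indicator_of_mem ?_ w).symm
    exact hF' I hI
  · intro I
    rw [ENNReal.coe_toNNReal (havg I), dyAvg, mul_right_comm,
      ENNReal.inv_mul_cancel I.2.ne' (measure_dyCube_ne_top μ I.1), one_mul]
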